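/- There exists an upho poset P (on a countable underlying type) whose rank-generating function is uncomputable: no computable function f : ℕ → ℕ satisfies f(n) = |P_n| for all n ≥ 0, where P_n is the n-th rank level of P. -/

import Mathlib

/-- A poset `P` with rank function `ρ` is ranked: minimal elements have rank `0`,
and ranks increase by one along cover relations. -/
def IsRanked {P : Type*} [PartialOrder P] (ρ : P → ℕ) : Prop :=
  (∀ x : P, (∀ y : P, ¬ y < x) → ρ x = 0) ∧ ∀ x y : P, x ⋖ y → ρ y = ρ x + 1

/-- A ranked poset is of finite type if each rank level is finite. -/
def IsFiniteType {P : Type*} [PartialOrder P] (ρ : P → ℕ) : Prop :=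
  ∀ n : ℕ, {x : P | ρ x = n}.Finite

/-- A ranked poset of finite type is upho if every principal order filter,
with the induced order, is order-isomorphic to the whole poset. -/
def IsUpho (P : Type*) [PartialOrder P] (ρ : P → ℕ) : Prop :=
  IsRanked ρ ∧ IsFiniteType ρ ∧ ∀ s : P, Nonempty ({t : P // s ≤ t} ≃o P)

namespace UphoWords

/-- The word `t` contains the letter `2`, and the position of its first occurrence lies
in `S`. -/
def FirstTwoIn : Set ℕ → List (Fin 3) → Prop
  | _, [] => False
  | S, x :: t => if x = 2 then 0 ∈ S else FirstTwoIn {n | n + 1 ∈ S} t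

open Classical in
/-- Left multiplication of a word by a letter in the monoid generated by `0, 1, 2` subject to
`0 * t = 1 * t` whenever `FirstTwoIn S t`. -/
noncomputable def consMul (S : Set ℕ) (x : Fin 3) (t : List (Fin 3)) : List (Fin 3) :=
  if x = 0 ∧ FirstTwoIn S t then 1 :: t else x :: t

/-- Left multiplication of the word `t` by the word `w`. -/
noncomputable def mul (S : Set ℕ) (w t : List (Fin 3)) : List (Fin 3) :=
  w.foldr (consMul S) t

variable {S T : Set ℕ}

@[simp] theorem mul_nil_left (t : List (Fin 3)) : mul S [] t = t := rfl

@[simp] theorem mul_cons (x : Fin 3) (w t : List (Fin 3)) :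
    mul S (x :: w) t = consMul S x (mul S w t) := rfl

@[simp] theorem tail_consMul (x : Fin 3) (t : List (Fin 3)) : (consMul S x t).tail = t := by
  unfold consMul; split_ifs <;> rfl

@[simp] theorem length_consMul (x : Fin 3) (t : List (Fin 3)) :
    (consMul S x t).length = t.length + 1 := by
  unfold consMul; split_ifs <;> rfl

theorem length_mul (w t : List (Fin 3)) : (mul S w t).length = w.length + t.length := by
  induction w with
  | nil => simp
  | cons x w ih => simp [ih]; omega

theorem mul_right_injective (w : List (Fin 3)) : Function.Injective (mul S w) := by
  induction w with
  | nil => exact fun _ _ h => h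
  | cons x w ih =>
    intro t u h
    exact ih (by simpa using congrArg List.tail h)

theorem firstTwoIn_consMul (x : Fin 3) (t : List (Fin 3)) :
    FirstTwoIn T (consMul S x t) ↔ if x = 2 then 0 ∈ T else FirstTwoIn {n | n + 1 ∈ T} t := by
  unfold consMul
  split_ifs with h h' <;> simp_all [FirstTwoIn]

theorem FirstTwoIn.mul {v : List (Fin 3)} (h : FirstTwoIn T v) (t : List (Fin 3)) :
    FirstTwoIn T (mul S v t) := by
  induction v generalizing T with
  | nil => exact h.elim
  | cons x v ih =>
    rw [mul_cons, firstTwoIn_consMul]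
    rw [FirstTwoIn] at h
    split_ifs at h ⊢ with hx
    · exact h
    · exact ih h

theorem consMul_mul (x : Fin 3) (v t : List (Fin 3)) :
    mul S (consMul S x v) t = consMul S x (mul S v t) := by
  by_cases h : x = 0 ∧ FirstTwoIn S v
  · have h' := h.2.mul (S := S) t
    simp [consMul, h.1, h.2, h']
  · rw [consMul, if_neg h, mul_cons]

theorem mul_assoc (w u t : List (Fin 3)) : mul S (mul S w u) t = mul S w (mul S u t) := by
  induction w with
  | nil => rfl
  | cons x w ih => rw [mul_cons, mul_cons, consMul_mul, ih]

/-- The words in normal form; they represent the elements of the monoid. -/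
def NormalWord (S : Set ℕ) : Type := {w : List (Fin 3) // mul S w [] = w}

namespace NormalWord

instance : Countable (NormalWord S) := Subtype.countable

/-- Left divisibility. -/
instance : PartialOrder (NormalWord S) where
  le v w := ∃ u, mul S v.1 u = w.1
  le_refl v := ⟨[], v.2⟩
  le_trans := by
    rintro v w z ⟨u, hu⟩ ⟨t, ht⟩
    exact ⟨mul S u t, by rw [← mul_assoc, hu, ht]⟩
  le_antisymm := by
    rintro v w ⟨u, hu⟩ ⟨t, ht⟩
    have h₁ := congrArg List.length hu
    have h₂ := congrArg List.length ht
    rw [length_mul] at h₁ h₂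
    obtain rfl : u = [] := List.length_eq_zero_iff.mp (by omega)
    exact Subtype.ext (v.2.symm.trans hu)

theorem le_iff {v w : NormalWord S} : v ≤ w ↔ ∃ u, mul S v.1 u = w.1 := Iff.rfl

/-- The length of a normal word. -/
def rank (w : NormalWord S) : ℕ := w.1.length

/-- The product of a normal word with an arbitrary word, in normal form. -/
noncomputable def append (v : NormalWord S) (u : List (Fin 3)) : NormalWord S :=
  ⟨mul S v.1 (mul S u []), by rw [mul_assoc, mul_assoc, mul_nil_left]⟩

theorem rank_append (v : NormalWord S) (u : List (Fin 3)) :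
    (v.append u).rank = v.rank + u.length := by
  simp [append, rank, length_mul]

theorem le_append (v : NormalWord S) (u : List (Fin 3)) : v ≤ v.append u := ⟨_, rfl⟩

theorem exists_append_of_le {v w : NormalWord S} (h : v ≤ w) : ∃ u, v.append u = w := by
  obtain ⟨u, hu⟩ := h
  exact ⟨u, Subtype.ext (show mul S v.1 (mul S u []) = w.1 by rw [← mul_assoc, hu, w.2])⟩

theorem append_append (v : NormalWord S) (u t : List (Fin 3)) :
    (v.append u).append t = v.append (mul S u t) :=
  Subtype.ext (by simp only [append, mul_assoc, mul_nil_left])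

theorem append_consMul (v : NormalWord S) (x : Fin 3) (u : List (Fin 3)) :
    v.append (consMul S x u) = v.append (x :: u) :=
  Subtype.ext (by simp only [append, consMul_mul, mul_cons])

theorem lt_append {v : NormalWord S} {u : List (Fin 3)} (hu : u ≠ []) : v < v.append u := by
  refine lt_of_le_of_ne (v.le_append u) fun h => hu ?_
  have := congrArg rank h
  rw [rank_append] at this
  exact List.length_eq_zero_iff.mp (by omega)

theorem isRanked : IsRanked (rank (S := S)) := by
  constructor
  · intro w hw
    by_contra h
    let e : NormalWord S := ⟨[], rfl⟩
    have he : e ≤ w := ⟨w.1, rfl⟩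
    refine hw e (lt_of_le_of_ne he ?_)
    rintro rfl
    exact h rfl
  · intro v w h
    obtain ⟨u, rfl⟩ := exists_append_of_le h.le
    rw [rank_append]
    cases u with
    | nil =>
      have := h.lt.ne
      exact absurd (Subtype.ext (by simp [append, v.2])) this
    | cons x u =>
      cases u with
      | nil => rfl
      | cons y u =>
        have := lt_append (v := v.append [x]) (u := y :: u) (by simp)
        rw [append_append, mul_cons, mul_nil_left, append_consMul] at this
        exact absurd this (h.2 (lt_append (by simp)))

theorem isFiniteType : IsFiniteType (rank (S := S)) := fun n =>
  (List.finite_length_eq (Fin 3) n).preimage Subtype.val_injective.injOn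

/-- Left multiplication by `s` identifies the poset with the principal filter of `s`. -/
noncomputable def mulLeft (s : NormalWord S) : NormalWord S ≃o {t : NormalWord S // s ≤ t} :=
  RelIso.ofSurjective
    (OrderEmbedding.ofMapLEIff
      (fun t => (⟨⟨mul S s.1 t.1, by rw [mul_assoc, t.2]⟩, t.1, rfl⟩ : {t // s ≤ t}))
      (by
        intro t u
        refine exists_congr fun v => ?_
        change mul S (mul S s.1 t.1) v = mul S s.1 u.1 ↔ _
        rw [mul_assoc, (mul_right_injective s.1).eq_iff]))
    (by
      rintro ⟨w, hw⟩
      obtain ⟨u, rfl⟩ := exists_append_of_le hw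
      exact ⟨⟨mul S u [], by rw [mul_assoc, mul_nil_left]⟩, rfl⟩)

theorem isUpho : IsUpho (NormalWord S) rank :=
  ⟨isRanked, isFiniteType, fun s => ⟨s.mulLeft.symm⟩⟩

end NormalWord

theorem mul_cons_nil_eq_self_iff {x : Fin 3} {t : List (Fin 3)} :
    mul S (x :: t) [] = x :: t ↔ mul S t [] = t ∧ ¬ (x = 0 ∧ FirstTwoIn S t) := by
  rw [mul_cons]
  constructor
  · intro h
    have ht : mul S t [] = t := by simpa using congrArg List.tail h
    refine ⟨ht, fun hx => ?_⟩
    rw [ht, consMul, if_pos hx, hx.1] at h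
    simp at h
  · rintro ⟨ht, hx⟩
    rw [ht, consMul, if_neg hx]

theorem FirstTwoIn.mono {t : List (Fin 3)} (h : FirstTwoIn S t)
    (hST : ∀ j < t.length, j ∈ S → j ∈ T) : FirstTwoIn T t := by
  induction t generalizing S T with
  | nil => exact h
  | cons x t ih =>
    rw [FirstTwoIn] at h ⊢
    split_ifs at h ⊢ with hx
    · exact hST 0 (by simp) h
    · exact ih h fun j hj => hST (j + 1) (by simpa using hj)

theorem mul_nil_eq_self_of_subset {w : List (Fin 3)} (hw : mul S w [] = w)
    (hTS : ∀ j, j + 1 < w.length → j ∈ T → j ∈ S) : mul T w [] = w := by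
  induction w with
  | nil => rfl
  | cons x t ih =>
    rw [mul_cons_nil_eq_self_iff] at hw ⊢
    refine ⟨ih hw.1 fun j hj => hTS j (by simp; omega), fun hx => hw.2 ⟨hx.1, hx.2.mono ?_⟩⟩
    exact fun j hj => hTS j (by simpa using hj)

theorem firstTwoIn_replicate_append (k : ℕ) :
    FirstTwoIn S (List.replicate k 1 ++ [2]) ↔ k ∈ S := by
  induction k generalizing S with
  | zero => simp [FirstTwoIn]
  | succ k ih => simp [List.replicate_succ, FirstTwoIn, ih]

theorem mul_replicate_append_nil (k : ℕ) :
    mul S (List.replicate k 1 ++ [2]) [] = List.replicate k 1 ++ [2] := by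
  induction k with
  | zero => simp [consMul]
  | succ k ih =>
    rw [List.replicate_succ, List.cons_append, mul_cons_nil_eq_self_iff]
    exact ⟨ih, by simp⟩

theorem card_rank_eq (n : ℕ) : Nat.card {w : NormalWord S // w.rank = n} =
    {w : List (Fin 3) | mul S w [] = w ∧ w.length = n}.ncard :=
  Nat.card_congr (Equiv.subtypeSubtypeEquivSubtypeInter (fun w => mul S w [] = w)
    (fun w => w.length = n))

theorem card_rank_lt {k : ℕ} (hS : k ∈ S) (hT : k ∉ T) (hST : ∀ j < k, j ∈ T → j ∈ S) :
    Nat.card {w : NormalWord S // w.rank = k + 2} <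
      Nat.card {w : NormalWord T // w.rank = k + 2} := by
  rw [card_rank_eq, card_rank_eq]
  refine Set.ncard_lt_ncard ?_ ((List.finite_length_eq (Fin 3) (k + 2)).subset fun w hw => hw.2)
  refine Set.ssubset_iff_exists.mpr ⟨?_, 0 :: (List.replicate k 1 ++ [2]), ⟨?_, by simp⟩, ?_⟩
  · rintro w ⟨hw, hlen⟩
    refine ⟨mul_nil_eq_self_of_subset hw fun j hj hjT => ?_, hlen⟩
    rcases (show j ≤ k by omega).lt_or_eq with h | rfl
    · exact hST j h hjT
    · exact absurd hjT hT
  · rw [mul_cons_nil_eq_self_iff, firstTwoIn_replicate_append]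
    exact ⟨mul_replicate_append_nil k, fun h => hT h.2⟩
  · rintro ⟨h, -⟩
    rw [mul_cons_nil_eq_self_iff] at h
    exact h.2 ⟨rfl, (firstTwoIn_replicate_append k).mpr hS⟩

theorem card_rank_injective :
    Function.Injective fun (S : Set ℕ) (n : ℕ) => Nat.card {w : NormalWord S // w.rank = n} := by
  intro S T h
  ext k
  induction k using Nat.strong_induction_on with
  | _ k ih =>
    have hk := congrFun h (k + 2)
    by_contra hne
    by_cases hS : k ∈ S
    · exact (card_rank_lt hS (by tauto) fun j hj => (ih j hj).mpr).ne hk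
    · exact (card_rank_lt (by tauto) hS fun j hj => (ih j hj).mp).ne' hk

end UphoWords

theorem countable_setOf_computable : {f : ℕ → ℕ | Computable f}.Countable := by
  have h : ∀ f : {f : ℕ → ℕ | Computable f}, ∃ c : Nat.Partrec.Code, c.eval = (f.1 : ℕ →. ℕ) :=
    fun f => Nat.Partrec.Code.exists_code.mp (Partrec.nat_iff.mp f.2)
  choose code hcode using h
  have hinj : Function.Injective code := by
    intro f g hfg
    have heq : (f.1 : ℕ →. ℕ) = g.1 := by rw [← hcode, ← hcode, hfg]
    exact Subtype.ext (funext fun n => Part.some_inj.mp (congrFun heq n))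
  exact hinj.countable

/-- There exists an upho poset `P` (on a countable underlying type) whose
rank-generating function is uncomputable: no computable function `f : ℕ → ℕ` satisfies
`f(n) = |P_n|` for all `n ≥ 0`, where `P_n` is the `n`-th rank level of `P`. -/
theorem exists_upho_uncomputable_rank_generating_function :
    ∃ (P : Type) (inst : PartialOrder P) (ρ : P → ℕ),
      Countable P ∧ @IsUpho P inst ρ ∧
      ∀ f : ℕ → ℕ, Computable f → ∃ n : ℕ, f n ≠ Nat.card {x : P // ρ x = n} := by
  by_contra! hcon
  have hmem : ∀ S : Set ℕ, (fun n => Nat.card {w : UphoWords.NormalWord S // w.rank = n}) ∈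
      {f : ℕ → ℕ | Computable f} := by
    intro S
    obtain ⟨f, hf, hfn⟩ := hcon (UphoWords.NormalWord S) inferInstance UphoWords.NormalWord.rank
      inferInstance UphoWords.NormalWord.isUpho
    rwa [← funext hfn]
  have := countable_setOf_computable.to_subtype
  have hcount : Countable (Set ℕ) :=
    (UphoWords.card_rank_injective.codRestrict hmem).countable
  obtain ⟨e, he⟩ := hcount
  exact Function.cantor_injective e he
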